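/- For every ψ ∈ Λ²₀₊, the operator ϑψ satisfies ρ(ϑψ) = -2ψ and ρ₁₃(ϑψ) = -(m+2)ψ. -/

import Mathlib

open Module
open scoped RealInnerProductSpace

variable {V : Type*} [NormedAddCommGroup V] [InnerProductSpace ℝ V] [FiniteDimensional ℝ V]

/-- The Ricci tensor `ρ(A)(x,y) = Tr (z ↦ A(z,x)y)`. -/
noncomputable def rho (A : V →ₗ[ℝ] V →ₗ[ℝ] V →ₗ[ℝ] V) (x y : V) : ℝ :=
  LinearMap.trace ℝ V ((A.flip x).flip y)

/-- for `ψ ∈ Λ²₀₊`, `ρ(ϑψ) = -2ψ` and `ρ₁₃(ϑψ) = -(m+2)ψ`. -/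
theorem statement14 {m : ℕ} (e : OrthonormalBasis (Fin m) ℝ V)
    (J : V →ₗ[ℝ] V) (hJ : ∀ v, J (J v) = -v)
    (hJinner : ∀ x y : V, ⟪J x, J y⟫ = ⟪x, y⟫)
    (φ : V →ₗ[ℝ] V →ₗ[ℝ] ℝ) (hsym : ∀ x y, φ x y = - φ y x)
    (hJφ : ∀ x y, φ (J x) (J y) = φ x y) (htr : ∑ i, φ (e i) (J (e i)) = 0)
    (T : V →ₗ[ℝ] V →ₗ[ℝ] V →ₗ[ℝ] V)
    (hT : ∀ x y z w : V, ⟪T x y z, w⟫ =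
      φ x w * ⟪y, z⟫ - φ y w * ⟪x, z⟫ + φ x (J w) * ⟪y, J z⟫ - φ y (J w) * ⟪x, J z⟫
        - 2 * φ z (J w) * ⟪x, J y⟫) :
    (∀ x y, rho T x y = (-2) * φ x y) ∧
    (∀ x y, (∑ i, ⟪T (e i) x (e i), y⟫) = -((m : ℝ) + 2) * φ x y) := by
  have key : ∀ (f : V →ₗ[ℝ] ℝ) (v : V), ∑ i, f (e i) * ⟪e i, v⟫ = f v := by
    intro f v
    conv_rhs => rw [← e.sum_repr' v]
    rw [map_sum]
    refine Finset.sum_congr rfl fun i _ => ?_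
    rw [map_smul, smul_eq_mul, mul_comm]
  have hskew : ∀ x y : V, ⟪x, J y⟫ = -⟪y, J x⟫ := by
    intro x y
    rw [← hJinner x (J y), hJ, inner_neg_right, real_inner_comm]
  have hdiag : ∀ x : V, φ x x = 0 := fun x => by linarith [hsym x x]
  have hJd : ∀ x : V, ⟪x, J x⟫ = 0 := fun x => by linarith [hskew x x]
  constructor
  · intro x y
    have h1 := key (φ x) y
    have h2 := key ((φ x).comp J) (J y)
    have h3 := key ((φ y).comp J) (J x)
    simp only [LinearMap.comp_apply, hJ, map_neg] at h2 h3
    unfold rho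
    rw [LinearMap.trace_eq_sum_inner _ e]
    have : ∀ i, ⟪e i, ((T.flip x).flip y) (e i)⟫ =
        - (φ x (e i) * ⟪e i, y⟫) + φ (e i) (J (e i)) * ⟪x, J y⟫
        - φ x (J (e i)) * ⟪e i, J y⟫ - 2 * (φ y (J (e i)) * ⟪e i, J x⟫) := by
      intro i
      rw [real_inner_comm, LinearMap.flip_apply, LinearMap.flip_apply, hT, hdiag]
      ring
    simp only [this, Finset.sum_sub_distrib, Finset.sum_add_distrib, Finset.sum_neg_distrib,
      ← Finset.mul_sum, ← Finset.sum_mul, h1, h2, h3, htr]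
    linarith [hsym x y]
  · intro x y
    have h1 := key (φ.flip y) x
    have h2 := key (φ.flip (J y)) (J x)
    simp only [LinearMap.flip_apply, hJφ] at h1 h2
    have : ∀ i, ⟪T (e i) x (e i), y⟫ =
        φ (e i) y * ⟪e i, x⟫ - φ x y - 3 * (φ (e i) (J y) * ⟪e i, J x⟫) := by
      intro i
      have h := e.orthonormal.1 i
      rw [hT, hJd, hskew x (e i), real_inner_comm (e i) x, real_inner_self_eq_norm_sq, h]
      ring
    simp only [this, Finset.sum_sub_distrib, ← Finset.mul_sum, h1, h2, Finset.sum_const,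
      Finset.card_univ, Fintype.card_fin, nsmul_eq_mul]
    ring
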